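/- Let ℂ² have basis e_{-1}, e_1, P° = Σ_{i,j∈{-1,1}} E_{ij}⊗E_{ji}, R°(u) = I − P°/u, and for an operator R on ℂ²⊗ℂ² let R_{ab} denote R acting on tensor factors a,b of (ℂ²)^{⊗4}. Define R_V(u) = ¼ R°₁₂(−1) R°₃₄(−1) R°₁₄(2u−1) R°₁₃(2u) R°₂₄(2u) R°₂₃(2u+1) ∈ End((ℂ²)^{⊗4}). Then, as identities of rational functions in u, ¼ R_V(u) R°₁₂(−1) R°₃₄(−1) = R_V(u) = ¼ R°₁₂(−1) R°₃₄(−1) R_V(u). -/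

import Mathlib

open Matrix Kronecker Finset

noncomputable section

/-- The index set `I_N` as a subtype of `ℤ` determined by a finite set `S ⊆ ℤ`. -/
abbrev Idx (S : Finset ℤ) : Type := {i : ℤ // i ∈ S}

/-- The matrix unit `E_{ab}` of `End(ℂ^N)` (zero if `a` or `b` is not in the index set). -/
def Emat (S : Finset ℤ) (a b : ℤ) : Matrix (Idx S) (Idx S) ℂ :=
  fun p q => if ((p : ℤ) = a ∧ (q : ℤ) = b) then 1 else 0

/-- The permutation operator `P = Σ_{i,j} E_{ij} ⊗ E_{ji}` on `ℂ^N ⊗ ℂ^N`. -/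
def Pmat (S : Finset ℤ) : Matrix (Idx S × Idx S) (Idx S × Idx S) ℂ :=
  ∑ i ∈ S, ∑ j ∈ S, Emat S i j ⊗ₖ Emat S j i

/-- The operator `Q = Σ_{i,j} θ_{ij} E_{ij} ⊗ E_{-i,-j}` on `ℂ^N ⊗ ℂ^N`. -/
def Qmat (S : Finset ℤ) (θ : ℤ → ℤ → ℂ) : Matrix (Idx S × Idx S) (Idx S × Idx S) ℂ :=
  ∑ i ∈ S, ∑ j ∈ S, θ i j • (Emat S i j ⊗ₖ Emat S (-i) (-j))

/-- The R-matrix `R(u) = I - P/u + Q/(u - κ)` of types B, C, D. -/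
def Rmat (S : Finset ℤ) (θ : ℤ → ℤ → ℂ) (κ u : ℂ) :
    Matrix (Idx S × Idx S) (Idx S × Idx S) ℂ :=
  1 - u⁻¹ • Pmat S + (u - κ)⁻¹ • Qmat S θ

/-- `θ_{ij} = 1` (orthogonal case). -/
def θorth : ℤ → ℤ → ℂ := fun _ _ => 1

/-- `θ_{ij} = sign(i)·sign(j)` (symplectic case). -/
def θsymp : ℤ → ℤ → ℂ := fun i j =>
  (if 0 < i then (1 : ℂ) else -1) * (if 0 < j then (1 : ℂ) else -1)

/-- The two-element index set `{-1, 1}` for `ℂ²`. -/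
def S2 : Finset ℤ := {-1, 1}

abbrev V2 : Type := Idx S2

/-- Negation `i ↦ -i` on the index set `{-1, 1}`. -/
def nneg (p : V2) : V2 :=
  ⟨-(p : ℤ), by
    have h := p.2
    simp only [S2, Finset.mem_insert, Finset.mem_singleton] at h ⊢
    omega⟩

/-- The rational R-matrix `R°(u) = I - P°/u` of type A on `ℂ² ⊗ ℂ²`. -/
def Ro (u : ℂ) : Matrix (V2 × V2) (V2 × V2) ℂ := 1 - u⁻¹ • Pmat S2

/-- `sign(i)` for `i ∈ {-1, 1}`. -/
def ssgn : V2 → ℂ := fun i => if 0 < (i : ℤ) then 1 else -1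

/-- Partial transpose applied to the first tensor factor of `ℂ² ⊗ ℂ²`, for the transpose
`M ↦ Σ_{i,j} s(i) s(j) M_{ij} E_{-j,-i}` of `2 × 2` matrices (take `s ≡ 1` for `t₊` and
`s = sign` for `t₋`). -/
def pt1 (s : V2 → ℂ) (X : Matrix (V2 × V2) (V2 × V2) ℂ) :
    Matrix (V2 × V2) (V2 × V2) ℂ :=
  fun p q => s p.1 * s q.1 * X (nneg q.1, p.2) (nneg p.1, q.2)

/-- The fourfold tensor power `(ℂ²)^{⊗4}` index type. -/
abbrev Q4 : Type := V2 × V2 × V2 × V2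

/-- `R_{12}` on `(ℂ²)^{⊗4}`. -/
def L12 (M : Matrix (V2 × V2) (V2 × V2) ℂ) : Matrix Q4 Q4 ℂ :=
  fun p q => M (p.1, p.2.1) (q.1, q.2.1) *
    (if (p.2.2.1, p.2.2.2) = (q.2.2.1, q.2.2.2) then 1 else 0)

/-- `R_{13}` on `(ℂ²)^{⊗4}`. -/
def L13 (M : Matrix (V2 × V2) (V2 × V2) ℂ) : Matrix Q4 Q4 ℂ :=
  fun p q => M (p.1, p.2.2.1) (q.1, q.2.2.1) *
    (if (p.2.1, p.2.2.2) = (q.2.1, q.2.2.2) then 1 else 0)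

/-- `R_{14}` on `(ℂ²)^{⊗4}`. -/
def L14 (M : Matrix (V2 × V2) (V2 × V2) ℂ) : Matrix Q4 Q4 ℂ :=
  fun p q => M (p.1, p.2.2.2) (q.1, q.2.2.2) *
    (if (p.2.1, p.2.2.1) = (q.2.1, q.2.2.1) then 1 else 0)

/-- `R_{23}` on `(ℂ²)^{⊗4}`. -/
def L23 (M : Matrix (V2 × V2) (V2 × V2) ℂ) : Matrix Q4 Q4 ℂ :=
  fun p q => M (p.2.1, p.2.2.1) (q.2.1, q.2.2.1) *
    (if (p.1, p.2.2.2) = (q.1, q.2.2.2) then 1 else 0)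

/-- `R_{24}` on `(ℂ²)^{⊗4}`. -/
def L24 (M : Matrix (V2 × V2) (V2 × V2) ℂ) : Matrix Q4 Q4 ℂ :=
  fun p q => M (p.2.1, p.2.2.2) (q.2.1, q.2.2.2) *
    (if (p.1, p.2.2.1) = (q.1, q.2.2.1) then 1 else 0)

/-- `R_{34}` on `(ℂ²)^{⊗4}`. -/
def L34 (M : Matrix (V2 × V2) (V2 × V2) ℂ) : Matrix Q4 Q4 ℂ :=
  fun p q => M (p.2.2.1, p.2.2.2) (q.2.2.1, q.2.2.2) *
    (if (p.1, p.2.1) = (q.1, q.2.1) then 1 else 0)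

/-- The fused `so₃` R-matrix
`R_V(u) = ¼ R°₁₂(-1) R°₃₄(-1) R°₁₄(2u-1) R°₁₃(2u) R°₂₄(2u) R°₂₃(2u+1)`. -/
def RV (u : ℂ) : Matrix Q4 Q4 ℂ :=
  (4 : ℂ)⁻¹ • (L12 (Ro (-1)) * L34 (Ro (-1)) * L14 (Ro (2 * u - 1)) * L13 (Ro (2 * u)) *
    L24 (Ro (2 * u)) * L23 (Ro (2 * u + 1)))

/-- The Yang–Baxter equation for `1 - P / u`, given the braid-type relations between
three transpositions. -/
theorem yang_baxter_of_transpositions {A : Type*} [Ring A] [Algebra ℂ A] {x y z : A}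
    (h₁ : x * y = y * z) (h₂ : y * z = z * x) (h₃ : y * x = z * y) (h₄ : z * y = x * z)
    {p q r : ℂ} (hp : p ≠ 0) (hq : q ≠ 0) (hr : r ≠ 0) (hpqr : q = p + r) :
    (1 - p⁻¹ • x) * (1 - q⁻¹ • y) * (1 - r⁻¹ • z) =
      (1 - r⁻¹ • z) * (1 - q⁻¹ • y) * (1 - p⁻¹ • x) := by
  have hc : p⁻¹ * r⁻¹ = p⁻¹ * q⁻¹ + q⁻¹ * r⁻¹ := by
    field_simp
    rw [hpqr]
    ring
  have h₅ : x * y * z = z * y * x := by rw [mul_assoc, h₂, h₄, mul_assoc]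
  have expand : ∀ (a b c : ℂ) (x y z : A), (1 - a • x) * (1 - b • y) * (1 - c • z) =
      1 - a • x - b • y - c • z + (a * b) • (x * y) + (a * c) • (x * z) + (b * c) • (y * z)
        - (a * b * c) • (x * y * z) := by
    intro a b c x y z
    simp only [mul_sub, sub_mul, mul_one, one_mul, smul_mul_assoc, mul_smul_comm, smul_smul,
      smul_sub]
    module
  rw [expand, expand, h₅, h₁, h₂, h₃, h₄, mul_comm r⁻¹ p⁻¹, hc]
  module

/-- If commuting `a` and `b` are twice idempotents and can each be moved across `m` (at the cost of
changing `m`), then multiplying `a * b * m` by `a * b` on either side only rescales it by `4`. -/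
theorem absorption_of_intertwining {A : Type*} [Ring A] [Algebra ℂ A] {a b m m₁ m₂ : A}
    (haa : a * a = (2 : ℂ) • a) (hbb : b * b = (2 : ℂ) • b) (hab : a * b = b * a)
    (ha : a * m = m₁ * a) (hb : b * m = m₂ * b) :
    a * b * m * (a * b) = (4 : ℂ) • (a * b * m) ∧
      a * b * (a * b * m) = (4 : ℂ) • (a * b * m) := by
  have hma : a * m * a = (2 : ℂ) • (a * m) := by
    rw [ha, mul_assoc, haa, mul_smul_comm]
  have hmb : b * m * b = (2 : ℂ) • (b * m) := by
    rw [hb, mul_assoc, hbb, mul_smul_comm]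
  constructor
  · calc
      a * b * m * (a * b) = b * (a * m * a) * b := by
          rw [← mul_assoc _ a b, hab]
          simp only [mul_assoc]
      _ = (2 : ℂ) • (a * (b * m * b)) := by
        rw [hma, mul_smul_comm, smul_mul_assoc, ← mul_assoc b a m, ← hab]
        simp only [mul_assoc]
      _ = (4 : ℂ) • (a * b * m) := by
        rw [hmb, mul_smul_comm, smul_smul, mul_assoc]
        norm_num
  · calc a * b * (a * b * m) = a * (b * a) * b * m := by simp only [mul_assoc]
      _ = (a * a) * (b * b) * m := by rw [← hab]; simp only [mul_assoc]
      _ = (4 : ℂ) • (a * b * m) := by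
        rw [haa, hbb, smul_mul_smul_comm, smul_mul_assoc]
        norm_num

theorem Pmat_apply (S : Finset ℤ) (p q : Idx S × Idx S) :
    Pmat S p q = if p.1 = q.2 ∧ p.2 = q.1 then 1 else 0 := by
  obtain ⟨⟨a, ha⟩, ⟨b, hb⟩⟩ := p
  obtain ⟨⟨c, hc⟩, ⟨d, hd⟩⟩ := q
  simp only [Pmat, Matrix.sum_apply, kroneckerMap_apply, Emat, Subtype.mk.injEq]
  rw [Finset.sum_eq_single_of_mem a ha, Finset.sum_eq_single_of_mem b hb]
  · by_cases h1 : a = d <;> by_cases h2 : b = c <;> simp [h1, h2, eq_comm]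
  · intro j _ hj
    simp [hj.symm]
  · intro i _ hi
    simp [hi.symm]

/-- The transposition of the tensor factors 1 and 2. -/
def swap12 : Equiv.Perm Q4 :=
  Function.Involutive.toPerm (fun p => (p.2.1, p.1, p.2.2.1, p.2.2.2)) fun _ => rfl

theorem swap12_apply (p : Q4) : swap12 p = (p.2.1, p.1, p.2.2.1, p.2.2.2) := rfl

/-- The transposition of the tensor factors 1 and 3. -/
def swap13 : Equiv.Perm Q4 :=
  Function.Involutive.toPerm (fun p => (p.2.2.1, p.2.1, p.1, p.2.2.2)) fun _ => rfl

theorem swap13_apply (p : Q4) : swap13 p = (p.2.2.1, p.2.1, p.1, p.2.2.2) := rfl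

/-- The transposition of the tensor factors 1 and 4. -/
def swap14 : Equiv.Perm Q4 :=
  Function.Involutive.toPerm (fun p => (p.2.2.2, p.2.1, p.2.2.1, p.1)) fun _ => rfl

theorem swap14_apply (p : Q4) : swap14 p = (p.2.2.2, p.2.1, p.2.2.1, p.1) := rfl

/-- The transposition of the tensor factors 2 and 3. -/
def swap23 : Equiv.Perm Q4 :=
  Function.Involutive.toPerm (fun p => (p.1, p.2.2.1, p.2.1, p.2.2.2)) fun _ => rfl

theorem swap23_apply (p : Q4) : swap23 p = (p.1, p.2.2.1, p.2.1, p.2.2.2) := rfl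

/-- The transposition of the tensor factors 2 and 4. -/
def swap24 : Equiv.Perm Q4 :=
  Function.Involutive.toPerm (fun p => (p.1, p.2.2.2, p.2.2.1, p.2.1)) fun _ => rfl

theorem swap24_apply (p : Q4) : swap24 p = (p.1, p.2.2.2, p.2.2.1, p.2.1) := rfl

/-- The transposition of the tensor factors 3 and 4. -/
def swap34 : Equiv.Perm Q4 :=
  Function.Involutive.toPerm (fun p => (p.1, p.2.1, p.2.2.2, p.2.2.1)) fun _ => rfl

theorem swap34_apply (p : Q4) : swap34 p = (p.1, p.2.1, p.2.2.2, p.2.2.1) := rfl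

theorem L12_Ro (x : ℂ) : L12 (Ro x) = 1 - x⁻¹ • swap12.permMatrix ℂ := by
  ext ⟨a, b, c, d⟩ ⟨a', b', c', d'⟩
  simp only [L12, Ro, Matrix.sub_apply, Matrix.smul_apply, Pmat_apply, Matrix.one_apply,
    Equiv.Perm.permMatrix, PEquiv.toMatrix_apply, Equiv.toPEquiv_apply, Option.mem_some_iff,
    swap12_apply, Prod.mk.injEq, smul_eq_mul]
  grind

theorem L13_Ro (x : ℂ) : L13 (Ro x) = 1 - x⁻¹ • swap13.permMatrix ℂ := by
  ext ⟨a, b, c, d⟩ ⟨a', b', c', d'⟩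
  simp only [L13, Ro, Matrix.sub_apply, Matrix.smul_apply, Pmat_apply, Matrix.one_apply,
    Equiv.Perm.permMatrix, PEquiv.toMatrix_apply, Equiv.toPEquiv_apply, Option.mem_some_iff,
    swap13_apply, Prod.mk.injEq, smul_eq_mul]
  grind

theorem L14_Ro (x : ℂ) : L14 (Ro x) = 1 - x⁻¹ • swap14.permMatrix ℂ := by
  ext ⟨a, b, c, d⟩ ⟨a', b', c', d'⟩
  simp only [L14, Ro, Matrix.sub_apply, Matrix.smul_apply, Pmat_apply, Matrix.one_apply,
    Equiv.Perm.permMatrix, PEquiv.toMatrix_apply, Equiv.toPEquiv_apply, Option.mem_some_iff,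
    swap14_apply, Prod.mk.injEq, smul_eq_mul]
  grind

theorem L23_Ro (x : ℂ) : L23 (Ro x) = 1 - x⁻¹ • swap23.permMatrix ℂ := by
  ext ⟨a, b, c, d⟩ ⟨a', b', c', d'⟩
  simp only [L23, Ro, Matrix.sub_apply, Matrix.smul_apply, Pmat_apply, Matrix.one_apply,
    Equiv.Perm.permMatrix, PEquiv.toMatrix_apply, Equiv.toPEquiv_apply, Option.mem_some_iff,
    swap23_apply, Prod.mk.injEq, smul_eq_mul]
  grind

theorem L24_Ro (x : ℂ) : L24 (Ro x) = 1 - x⁻¹ • swap24.permMatrix ℂ := by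
  ext ⟨a, b, c, d⟩ ⟨a', b', c', d'⟩
  simp only [L24, Ro, Matrix.sub_apply, Matrix.smul_apply, Pmat_apply, Matrix.one_apply,
    Equiv.Perm.permMatrix, PEquiv.toMatrix_apply, Equiv.toPEquiv_apply, Option.mem_some_iff,
    swap24_apply, Prod.mk.injEq, smul_eq_mul]
  grind

theorem L34_Ro (x : ℂ) : L34 (Ro x) = 1 - x⁻¹ • swap34.permMatrix ℂ := by
  ext ⟨a, b, c, d⟩ ⟨a', b', c', d'⟩
  simp only [L34, Ro, Matrix.sub_apply, Matrix.smul_apply, Pmat_apply, Matrix.one_apply,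
    Equiv.Perm.permMatrix, PEquiv.toMatrix_apply, Equiv.toPEquiv_apply, Option.mem_some_iff,
    swap34_apply, Prod.mk.injEq, smul_eq_mul]
  grind

theorem yang_baxter_123 {p q r : ℂ} (hp : p ≠ 0) (hq : q ≠ 0) (hr : r ≠ 0)
    (h : q = p + r) :
    L12 (Ro p) * L13 (Ro q) * L23 (Ro r) = L23 (Ro r) * L13 (Ro q) * L12 (Ro p) := by
  simp only [L12_Ro, L13_Ro, L23_Ro]
  refine yang_baxter_of_transpositions ?_ ?_ ?_ ?_ hp hq hr h <;>
    simp only [← Matrix.permMatrix_mul] <;> rfl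

theorem yang_baxter_124 {p q r : ℂ} (hp : p ≠ 0) (hq : q ≠ 0) (hr : r ≠ 0)
    (h : q = p + r) :
    L12 (Ro p) * L14 (Ro q) * L24 (Ro r) = L24 (Ro r) * L14 (Ro q) * L12 (Ro p) := by
  simp only [L12_Ro, L14_Ro, L24_Ro]
  refine yang_baxter_of_transpositions ?_ ?_ ?_ ?_ hp hq hr h <;>
    simp only [← Matrix.permMatrix_mul] <;> rfl

theorem yang_baxter_134 {p q r : ℂ} (hp : p ≠ 0) (hq : q ≠ 0) (hr : r ≠ 0)
    (h : q = p + r) :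
    L13 (Ro p) * L14 (Ro q) * L34 (Ro r) = L34 (Ro r) * L14 (Ro q) * L13 (Ro p) := by
  simp only [L13_Ro, L14_Ro, L34_Ro]
  refine yang_baxter_of_transpositions ?_ ?_ ?_ ?_ hp hq hr h <;>
    simp only [← Matrix.permMatrix_mul] <;> rfl

theorem yang_baxter_234 {p q r : ℂ} (hp : p ≠ 0) (hq : q ≠ 0) (hr : r ≠ 0)
    (h : q = p + r) :
    L23 (Ro p) * L24 (Ro q) * L34 (Ro r) = L34 (Ro r) * L24 (Ro q) * L23 (Ro p) := by
  simp only [L23_Ro, L24_Ro, L34_Ro]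
  refine yang_baxter_of_transpositions ?_ ?_ ?_ ?_ hp hq hr h <;>
    simp only [← Matrix.permMatrix_mul] <;> rfl

theorem L12_Ro_commute_L34_Ro (x y : ℂ) : Commute (L12 (Ro x)) (L34 (Ro y)) := by
  have h : Commute (swap12.permMatrix ℂ) (swap34.permMatrix ℂ) := by
    simp only [commute_iff_eq, ← Matrix.permMatrix_mul]
    rfl
  rw [L12_Ro, L34_Ro]
  exact ((Commute.one_left _).sub_left ((Commute.one_right _).sub_right
    (h.smul_right _) |>.smul_left _))

theorem L13_Ro_commute_L24_Ro (x y : ℂ) : Commute (L13 (Ro x)) (L24 (Ro y)) := by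
  have h : Commute (swap13.permMatrix ℂ) (swap24.permMatrix ℂ) := by
    simp only [commute_iff_eq, ← Matrix.permMatrix_mul]
    rfl
  rw [L13_Ro, L24_Ro]
  exact ((Commute.one_left _).sub_left ((Commute.one_right _).sub_right
    (h.smul_right _) |>.smul_left _))

theorem L12_Ro_neg_one_mul_self :
    L12 (Ro (-1)) * L12 (Ro (-1)) = (2 : ℂ) • L12 (Ro (-1)) := by
  have h : swap12.permMatrix ℂ * swap12.permMatrix ℂ = 1 := by
    rw [← Matrix.permMatrix_mul, show swap12 * swap12 = 1 from rfl, Matrix.permMatrix_one]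
  simp only [L12_Ro, inv_neg, inv_one, neg_smul, one_smul, sub_neg_eq_add, add_mul, mul_add,
    one_mul, mul_one, h]
  module

theorem L34_Ro_neg_one_mul_self :
    L34 (Ro (-1)) * L34 (Ro (-1)) = (2 : ℂ) • L34 (Ro (-1)) := by
  have h : swap34.permMatrix ℂ * swap34.permMatrix ℂ = 1 := by
    rw [← Matrix.permMatrix_mul, show swap34 * swap34 = 1 from rfl, Matrix.permMatrix_one]
  simp only [L34_Ro, inv_neg, inv_one, neg_smul, one_smul, sub_neg_eq_add, add_mul, mul_add,
    one_mul, mul_one, h]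
  module

/-- `¼ R_V(u) R°₁₂(-1) R°₃₄(-1) = R_V(u) = ¼ R°₁₂(-1) R°₃₄(-1) R_V(u)`. -/
theorem RV_projector_absorption (u : ℂ)
    (h1 : 2 * u - 1 ≠ 0) (h0 : 2 * u ≠ 0) (h2 : 2 * u + 1 ≠ 0) :
    (4 : ℂ)⁻¹ • (RV u * (L12 (Ro (-1)) * L34 (Ro (-1)))) = RV u ∧
    RV u = (4 : ℂ)⁻¹ • (L12 (Ro (-1)) * L34 (Ro (-1)) * RV u) := by
  have hn : (-1 : ℂ) ≠ 0 := by norm_num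
  have hA : L12 (Ro (-1)) * (L14 (Ro (2 * u - 1)) * L13 (Ro (2 * u)) * L24 (Ro (2 * u)) *
      L23 (Ro (2 * u + 1))) = L24 (Ro (2 * u)) * L14 (Ro (2 * u - 1)) *
        (L23 (Ro (2 * u + 1)) * L13 (Ro (2 * u))) * L12 (Ro (-1)) := by
    have e₁ := yang_baxter_124 hn h1 h0 (by ring)
    have e₂ := yang_baxter_123 hn h0 h2 (by ring)
    rw [mul_assoc (L14 _), (L13_Ro_commute_L24_Ro _ _).eq]
    calc _ = (L12 (Ro (-1)) * L14 (Ro (2 * u - 1)) * L24 (Ro (2 * u))) *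
          (L13 (Ro (2 * u)) * L23 (Ro (2 * u + 1))) := by simp only [mul_assoc]
      _ = L24 (Ro (2 * u)) * L14 (Ro (2 * u - 1)) *
          (L12 (Ro (-1)) * L13 (Ro (2 * u)) * L23 (Ro (2 * u + 1))) := by
        rw [e₁]; simp only [mul_assoc]
      _ = _ := by rw [e₂]; simp only [mul_assoc]
  have hB : L34 (Ro (-1)) * (L14 (Ro (2 * u - 1)) * L13 (Ro (2 * u)) * L24 (Ro (2 * u)) *
      L23 (Ro (2 * u + 1))) = L13 (Ro (2 * u)) * L14 (Ro (2 * u - 1)) *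
        (L23 (Ro (2 * u + 1)) * L24 (Ro (2 * u))) * L34 (Ro (-1)) := by
    have e₁ := yang_baxter_134 h0 h1 hn (by ring)
    have e₂ := yang_baxter_234 h2 h0 hn (by ring)
    calc _ = (L34 (Ro (-1)) * L14 (Ro (2 * u - 1)) * L13 (Ro (2 * u))) *
          (L24 (Ro (2 * u)) * L23 (Ro (2 * u + 1))) := by simp only [mul_assoc]
      _ = L13 (Ro (2 * u)) * L14 (Ro (2 * u - 1)) *
          (L34 (Ro (-1)) * L24 (Ro (2 * u)) * L23 (Ro (2 * u + 1))) := by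
        rw [← e₁]; simp only [mul_assoc]
      _ = _ := by rw [← e₂]; simp only [mul_assoc]
  obtain ⟨hr, hl⟩ := absorption_of_intertwining L12_Ro_neg_one_mul_self
    L34_Ro_neg_one_mul_self (L12_Ro_commute_L34_Ro _ _).eq hA hB
  simp only [← mul_assoc] at hr hl
  constructor
  · simp only [RV, smul_mul_assoc, ← mul_assoc, hr]
    module
  · simp only [RV, mul_smul_comm, ← mul_assoc, hl]
    module
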